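/- arXiv:1407.1891 — 4 statements merged into one kernel-verified Lean document; each statement's English description precedes it below -/
import Mathlib

section
/- Let s be a positive integer and let θ, ψ ∈ ℝ^s. Suppose that for every v ∈ ℤ^s, if vᵀθ ∈ ℤ then vᵀψ ∈ ℤ (i.e., every integer relation modulo ℤ among the coordinates of θ also holds among those of ψ). Then for every ε > 0 there exist a natural number n and a vector p ∈ ℤ^s such that ‖nθ − p − ψ‖_∞ ≤ ε. -/
open Finset in
/-- The Fourier expansion of `cos (π x) ^ (2m)`. -/
theorem ofReal_cos_pi_mul_pow_eq_sum (m : ℕ) (x : ℝ) :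
    ((Real.cos (Real.pi * x) ^ (2 * m) : ℝ) : ℂ) =
      ∑ j ∈ range (2 * m + 1), (((2 * m).choose j / 4 ^ m : ℝ) : ℂ) *
        Complex.exp (((2 * Real.pi * (((j : ℤ) - m : ℤ) * x) : ℝ) : ℂ) * Complex.I) := by
  push_cast
  rw [Complex.cos, div_pow, add_pow, pow_mul (2 : ℂ), sum_div]
  refine sum_congr rfl fun j hj => ?_
  have hj' : j ≤ 2 * m := by simpa [Nat.lt_succ_iff] using hj
  rw [← Complex.exp_nat_mul, ← Complex.exp_nat_mul, ← Complex.exp_add, Nat.cast_sub hj']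
  have : (j : ℂ) * (Real.pi * x * Complex.I)
      + ((2 * m : ℕ) - j : ℂ) * (-(Real.pi * x) * Complex.I)
      = 2 * Real.pi * ((j - m) * x) * Complex.I := by
    push_cast; ring
  rw [this]
  norm_num
  ring

open Finset in
/-- The multivariate Fourier expansion of `∏ i, cos (π x_i) ^ (2m)`. -/
theorem prod_cos_pi_mul_pow_eq_sum {ι : Type*} [Fintype ι] [DecidableEq ι] (m : ℕ) (x : ι → ℝ) :
    ∏ i, Real.cos (Real.pi * x i) ^ (2 * m) =
      ∑ k ∈ Fintype.piFinset fun _ : ι => range (2 * m + 1),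
        (∏ i, ((2 * m).choose (k i) / 4 ^ m : ℝ)) *
          Real.cos (2 * Real.pi * ∑ i, (((k i : ℤ) - m : ℤ) : ℝ) * x i) := by
  have key : ((∏ i, Real.cos (Real.pi * x i) ^ (2 * m) : ℝ) : ℂ) =
      ∑ k ∈ Fintype.piFinset fun _ : ι => range (2 * m + 1),
        ((∏ i, ((2 * m).choose (k i) / 4 ^ m : ℝ) : ℝ) : ℂ) *
          Complex.exp (((2 * Real.pi * ∑ i, (((k i : ℤ) - m : ℤ) : ℝ) * x i : ℝ) : ℂ)
            * Complex.I) := by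
    rw [Complex.ofReal_prod]
    simp_rw [ofReal_cos_pi_mul_pow_eq_sum]
    rw [prod_univ_sum]
    refine sum_congr rfl fun k _ => ?_
    rw [prod_mul_distrib, ← Complex.exp_sum, Complex.ofReal_prod, mul_sum, Complex.ofReal_sum,
      sum_mul]
  have := congrArg Complex.re key
  rw [Complex.ofReal_re, Complex.re_sum] at this
  simpa only [Complex.re_ofReal_mul, Complex.exp_ofReal_mul_I_re] using this

open Finset in
/-- If `β` is an integer whenever `α` is, then the sums of `cos (2π (nα - β))` are bounded below. -/
theorem exists_neg_le_sum_cos (α β : ℝ) (h : (∃ a : ℤ, α = a) → ∃ b : ℤ, β = b) :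
    ∃ C : ℝ, ∀ N : ℕ, -C ≤ ∑ n ∈ range N, Real.cos (2 * Real.pi * (n * α - β)) := by
  by_cases hα : ∃ a : ℤ, α = a
  · obtain ⟨b, hb⟩ := h hα
    obtain ⟨a, ha⟩ := hα
    refine ⟨0, fun N => ?_⟩
    rw [neg_zero]
    refine sum_nonneg fun n _ => ?_
    have : 2 * Real.pi * (n * α - β) = ((n * a - b : ℤ) : ℝ) * (2 * Real.pi) := by
      rw [ha, hb]; push_cast; ring
    rw [this, Real.cos_int_mul_two_pi]
    exact zero_le_one
  · set z : ℂ := Complex.exp (((2 * Real.pi * α : ℝ) : ℂ) * Complex.I) with hz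
    have hz1 : z ≠ 1 := by
      intro h1
      obtain ⟨a, ha⟩ := Complex.exp_eq_one_iff.1 h1
      refine hα ⟨a, ?_⟩
      have h2 : ((2 * Real.pi * α : ℝ) : ℂ) = ((a * (2 * Real.pi) : ℝ) : ℂ) := by
        apply mul_right_cancel₀ Complex.I_ne_zero
        rw [ha]; push_cast; ring
      have h3 : 2 * Real.pi * α = a * (2 * Real.pi) := by exact_mod_cast h2
      have := Real.pi_pos
      apply mul_left_cancel₀ (ne_of_gt (by positivity : 0 < 2 * Real.pi))
      rw [h3]; ring
    have hzn : ‖z‖ = 1 := Complex.norm_exp_ofReal_mul_I _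
    set w : ℂ := Complex.exp (((-(2 * Real.pi * β) : ℝ) : ℂ) * Complex.I) with hw
    have hwn : ‖w‖ = 1 := Complex.norm_exp_ofReal_mul_I _
    refine ⟨2 / ‖z - 1‖, fun N => ?_⟩
    have hsum : ∑ n ∈ range N, Real.cos (2 * Real.pi * (n * α - β))
        = ((∑ n ∈ range N, z ^ n) * w).re := by
      rw [sum_mul, Complex.re_sum]
      refine sum_congr rfl fun n _ => ?_
      rw [← Complex.exp_ofReal_mul_I_re, hz, hw, ← Complex.exp_nat_mul, ← Complex.exp_add]
      congr 2
      push_cast; ring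
    have hbound : ‖(∑ n ∈ range N, z ^ n) * w‖ ≤ 2 / ‖z - 1‖ := by
      rw [norm_mul, hwn, mul_one, geom_sum_eq hz1, norm_div]
      gcongr
      calc ‖z ^ N - 1‖ ≤ ‖z ^ N‖ + ‖(1 : ℂ)‖ := norm_sub_le _ _
        _ = 2 := by rw [norm_pow, hzn, one_pow, norm_one]; norm_num
    rw [hsum]
    exact (abs_le.1 ((Complex.abs_re_le_norm _).trans hbound)).1

/-- A quadratic bound for `cos (π x) ^ 2` in terms of the distance of `x` to the integers. -/
theorem cos_pi_mul_sq_le (x : ℝ) :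
    Real.cos (Real.pi * x) ^ 2 ≤ 1 - 2 * |x - round x| ^ 2 := by
  set y := x - round x with hy
  have hy2 : |y| ≤ 1 / 2 := abs_sub_round x
  have hπ := Real.pi_pos
  have hcos : Real.cos (Real.pi * x) ^ 2 = Real.cos (Real.pi * y) ^ 2 := by
    have h1 : Real.pi * y = Real.pi * x - round x * Real.pi := by rw [hy]; ring
    rw [h1, Real.cos_sub_int_mul_pi, mul_pow, ← sq_abs ((-1 : ℝ) ^ round x), abs_zpow,
      abs_neg, abs_one, one_zpow, one_pow, one_mul]
  obtain ⟨h1, h2⟩ := abs_le.1 hy2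
  have h0 : 0 ≤ Real.cos (Real.pi * y) :=
    Real.cos_nonneg_of_neg_pi_div_two_le_of_le (by nlinarith) (by nlinarith)
  have hq : Real.cos (Real.pi * y) ≤ 1 - 2 / Real.pi ^ 2 * (Real.pi * y) ^ 2 := by
    apply Real.cos_le_one_sub_mul_cos_sq
    rw [abs_mul, abs_of_pos hπ]
    nlinarith
  have he : 2 / Real.pi ^ 2 * (Real.pi * y) ^ 2 = 2 * y ^ 2 := by field_simp
  rw [hcos, sq_abs]
  nlinarith [Real.cos_le_one (Real.pi * y)]

open Finset in
/-- If integer relations modulo `ℤ` among the `θ i` also hold among the `ψ i`, then the mean of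
`∏ i, cos (π (n θ i - ψ i)) ^ (2m)` over `n` is at least its constant Fourier coefficient. -/
theorem exists_mul_sub_le_sum_prod_cos {ι : Type*} [Fintype ι] (θ ψ : ι → ℝ)
    (h : ∀ v : ι → ℤ, (∃ a : ℤ, ∑ i, (v i : ℝ) * θ i = a) → ∃ b : ℤ, ∑ i, (v i : ℝ) * ψ i = b)
    (m : ℕ) :
    ∃ C : ℝ, ∀ N : ℕ, N * ((2 * m).choose m / 4 ^ m : ℝ) ^ Fintype.card ι - C ≤
      ∑ n ∈ range N, ∏ i, Real.cos (Real.pi * (n * θ i - ψ i)) ^ (2 * m) := by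
  classical
  choose C hC using fun k : ι → ℕ =>
    exists_neg_le_sum_cos _ _ (h fun i => (k i : ℤ) - m)
  set t := Fintype.piFinset fun _ : ι => range (2 * m + 1)
  set c : (ι → ℕ) → ℝ := fun k => ∏ i, ((2 * m).choose (k i) / 4 ^ m : ℝ)
  have hc : ∀ k, 0 ≤ c k := fun k => prod_nonneg fun i _ => by positivity
  set k₀ : ι → ℕ := fun _ => m
  have hk₀ : k₀ ∈ t := Fintype.mem_piFinset.2 fun i => mem_range.2 (by simp only [k₀]; omega)
  refine ⟨∑ k ∈ t.erase k₀, c k * C k, fun N => ?_⟩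
  have hsum : ∑ n ∈ range N, ∏ i, Real.cos (Real.pi * (n * θ i - ψ i)) ^ (2 * m) =
      ∑ k ∈ t, c k * ∑ n ∈ range N, Real.cos (2 * Real.pi *
        (n * (∑ i, (((k i : ℤ) - m : ℤ) : ℝ) * θ i) - ∑ i, (((k i : ℤ) - m : ℤ) : ℝ) * ψ i)) := by
    simp_rw [prod_cos_pi_mul_pow_eq_sum]
    rw [sum_comm]
    refine sum_congr rfl fun k _ => ?_
    rw [mul_sum]
    refine sum_congr rfl fun n _ => ?_
    congr 3
    rw [mul_sum, ← sum_sub_distrib]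
    exact sum_congr rfl fun i _ => by ring
  rw [hsum, ← add_sum_erase t _ hk₀]
  have h1 : ∑ n ∈ range N, Real.cos (2 * Real.pi *
      (n * (∑ i, (((k₀ i : ℤ) - m : ℤ) : ℝ) * θ i) - ∑ i, (((k₀ i : ℤ) - m : ℤ) : ℝ) * ψ i))
      = N := by simp [k₀]
  have h2 : c k₀ = ((2 * m).choose m / 4 ^ m : ℝ) ^ Fintype.card ι := by simp [c, k₀, div_pow]
  have h3 := sum_le_sum fun k (_ : k ∈ t.erase k₀) => mul_le_mul_of_nonneg_left (hC k N) (hc k)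
  simp only [mul_neg, sum_neg_distrib] at h3
  rw [h1, h2]
  linarith

/-- A real number `a` with `N * a - C ≤ N * b` for all natural numbers `N` satisfies `a ≤ b`. -/
theorem le_of_forall_nat_mul_sub_le {a b C : ℝ} (h : ∀ N : ℕ, N * a - C ≤ N * b) : a ≤ b := by
  by_contra! hab
  obtain ⟨N, hN⟩ := exists_nat_gt (C / (a - b))
  rw [div_lt_iff₀ (sub_pos.2 hab)] at hN
  linarith [h N]


/-- **Kronecker's theorem on simultaneous Diophantine approximation.**
If every integer relation (modulo ℤ) among the coordinates of θ also holds among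
those of ψ, then for every ε > 0 there are n ∈ ℕ and p ∈ ℤ^s with
‖nθ − p − ψ‖_∞ ≤ ε. -/
theorem kronecker_simultaneous_approximation
    (s : ℕ) (hs : 0 < s) (θ ψ : Fin s → ℝ)
    (h : ∀ v : Fin s → ℤ,
      (∃ m : ℤ, (∑ i, (v i : ℝ) * θ i) = (m : ℝ)) →
      (∃ m : ℤ, (∑ i, (v i : ℝ) * ψ i) = (m : ℝ)))
    (ε : ℝ) (hε : 0 < ε) :
    ∃ (n : ℕ) (p : Fin s → ℤ),
      ∀ i, |(n : ℝ) * θ i - (p i : ℝ) - ψ i| ≤ ε := by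
  by_contra! hcon
  have hfar : ∀ n : ℕ, ∃ i, Real.cos (Real.pi * (n * θ i - ψ i)) ^ 2 ≤ 1 - 2 * ε ^ 2 := by
    intro n
    obtain ⟨i, hi⟩ := hcon n fun i => round (n * θ i - ψ i)
    refine ⟨i, (cos_pi_mul_sq_le _).trans ?_⟩
    rw [sub_right_comm] at hi
    gcongr
  set q : ℝ := 1 - 2 * ε ^ 2 with hq
  have hq0 : 0 ≤ q := (hfar 0).elim fun i hi => (sq_nonneg _).trans hi
  have hq1 : q < 1 := by rw [hq]; nlinarith
  have hupper : ∀ m n : ℕ, ∏ i, Real.cos (Real.pi * (n * θ i - ψ i)) ^ (2 * m) ≤ q ^ m := by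
    intro m n
    obtain ⟨i, hi⟩ := hfar n
    simp_rw [pow_mul]
    rw [← Finset.mul_prod_erase _ _ (Finset.mem_univ i)]
    calc _ ≤ q ^ m * 1 := by
          gcongr
          exact Finset.prod_le_one (fun j _ => by positivity)
            fun j _ => pow_le_one₀ (sq_nonneg _) (Real.cos_sq_le_one _)
      _ = q ^ m := mul_one _
  have hlower : ∀ m : ℕ, ((2 * m).choose m / 4 ^ m : ℝ) ^ s ≤ q ^ m := by
    intro m
    obtain ⟨C, hC⟩ := exists_mul_sub_le_sum_prod_cos θ ψ h m
    rw [Fintype.card_fin] at hC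
    refine le_of_forall_nat_mul_sub_le (C := C) fun N => (hC N).trans ?_
    refine (Finset.sum_le_sum fun n _ => hupper m n).trans_eq ?_
    simp
  have hlim : Filter.Tendsto (fun m : ℕ => 2 ^ s * ((m : ℝ) ^ s * q ^ m)) Filter.atTop (nhds 0) := by
    simpa using (tendsto_pow_const_mul_const_pow_of_lt_one s hq0 hq1).const_mul (2 ^ s : ℝ)
  obtain ⟨m, hm1, hm⟩ := ((hlim.eventually (gt_mem_nhds one_pos)).and
    (Filter.eventually_gt_atTop 0)).exists
  have hcentral : 1 ≤ 2 * (m : ℝ) * ((2 * m).choose m / 4 ^ m) := by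
    have := Nat.four_pow_le_two_mul_self_mul_centralBinom m hm
    rw [Nat.centralBinom_eq_two_mul_choose] at this
    rw [← mul_div_assoc, le_div_iff₀ (by positivity), one_mul]
    exact_mod_cast this
  have := calc (1 : ℝ) ≤ (2 * (m : ℝ) * ((2 * m).choose m / 4 ^ m)) ^ s := one_le_pow₀ hcentral
    _ = (2 * (m : ℝ)) ^ s * ((2 * m).choose m / 4 ^ m) ^ s := mul_pow _ _ _
    _ ≤ (2 * (m : ℝ)) ^ s * q ^ m := by gcongr; exact hlower m
    _ = 2 ^ s * ((m : ℝ) ^ s * q ^ m) := by ring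
  linarith
end

section
/- (Skolem–Mahler–Lech) Let u_n = Σ_{j=1}^{l} p_j(n) λ_jⁿ, where λ₁,…,λ_l are distinct nonzero complex numbers and p₁,…,p_l ∈ ℂ[x]. Then the set {n ∈ ℕ : u_n = 0} is the union of a finite set and finitely many infinite arithmetic progressions. Moreover, if the sequence is non-degenerate, i.e., λ_i/λ_j is not a root of unity for all i ≠ j, and the polynomials p_j are not all zero, then the set {n ∈ ℕ : u_n = 0} is finite. -/
open Polynomial in
/-- If the `j`-th coefficient of `P` is divisible by `p ^ (j + s)`, then so is every value of `P`,
up to an additional factor `p` for each root. -/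
theorem Polynomial.pow_dvd_eval_of_roots {R : Type*} [CommRing R] [IsDomain R] (p : R)
    (A : Finset R) (P : R[X]) (s : ℕ) (hP : ∀ j, p ^ (j + s) ∣ P.coeff j)
    (hA : ∀ a ∈ A, P.eval a = 0) (m : R) : p ^ (s + A.card) ∣ P.eval m := by
  classical
  induction A using Finset.induction_on generalizing P s with
  | empty =>
    rw [eval_eq_sum_range]
    exact Finset.dvd_sum fun j _ => Dvd.dvd.mul_right
      ((pow_dvd_pow _ (by rw [Finset.card_empty]; omega)).trans (hP j)) _
  | insert a A ha ih =>
    obtain ⟨Q, rfl⟩ := dvd_iff_isRoot.mpr (hA a (by simp))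
    have hQ : ∀ d j, Q.natDegree < j + d → p ^ (j + (s + 1)) ∣ Q.coeff j := by
      intro d
      induction d with
      | zero => intro j hj; rw [coeff_eq_zero_of_natDegree_lt (by omega)]; exact dvd_zero _
      | succ d ihd =>
        intro j hj
        have h1 := ihd (j + 1) (by omega)
        have h2 := hP (j + 1)
        rw [sub_mul, coeff_sub, coeff_X_mul, coeff_C_mul] at h2
        have h3 := dvd_add h2 (((pow_dvd_pow p (by omega)).trans h1).mul_left a)
        rw [sub_add_cancel] at h3
        exact (pow_dvd_pow p (by omega)).trans h3
    have h := ih Q (s + 1) (fun j => hQ (Q.natDegree + 1) j (by omega)) (fun b hb => by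
      have := hA b (by simp [hb])
      rw [eval_mul, mul_eq_zero] at this
      refine this.resolve_left ?_
      simp only [eval_sub, eval_X, eval_C, sub_eq_zero]
      rintro rfl
      exact ha hb)
    rw [Finset.card_insert_of_notMem ha, eval_mul]
    exact (pow_dvd_pow p (by omega)).trans (h.mul_left _)

/-- The iterated forward differences of `f` are divisible by increasing powers of `q`. -/
def HasDivisibleDiffs {R : Type*} [CommRing R] (q : R) (a : ℕ) (f : ℕ → R) : Prop :=
  ∀ k n, q ^ (a + k) ∣ (fwdDiff 1)^[k] f n

namespace HasDivisibleDiffs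

variable {R : Type*} [CommRing R] {q : R} {a b : ℕ} {f g : ℕ → R}

theorem add (hf : HasDivisibleDiffs q a f) (hg : HasDivisibleDiffs q a g) :
    HasDivisibleDiffs q a (f + g) := fun k n => by
  rw [fwdDiff_iter_add]
  exact dvd_add (hf k n) (hg k n)

theorem zero : HasDivisibleDiffs q a (0 : ℕ → R) := fun k n => by
  have : (0 : ℕ → R) = (0 : R) • (0 : ℕ → R) := by simp
  rw [this, fwdDiff_iter_const_smul]
  simp

theorem sum {ι : Type*} (s : Finset ι) (f : ι → ℕ → R)
    (h : ∀ i ∈ s, HasDivisibleDiffs q a (f i)) : HasDivisibleDiffs q a (∑ i ∈ s, f i) :=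
  Finset.sum_induction f (HasDivisibleDiffs q a) (fun _ _ => add) zero h

theorem succ (hf : HasDivisibleDiffs q a f) : HasDivisibleDiffs q (a + 1) (fwdDiff 1 f) :=
  fun k n => by
    rw [← Function.iterate_succ_apply, add_right_comm]
    exact hf (k + 1) n

theorem mul (hf : HasDivisibleDiffs q a f) (hg : HasDivisibleDiffs q b g) :
    HasDivisibleDiffs q (a + b) (f * g) := by
  intro k
  induction k generalizing f g a b with
  | zero =>
    intro n
    have h := mul_dvd_mul (hf 0 n) (hg 0 n)
    rw [← pow_add] at h
    exact h
  | succ k ih =>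
    intro n
    have key : fwdDiff 1 (f * g) =
        fwdDiff 1 f * g + (f * fwdDiff 1 g + fwdDiff 1 f * fwdDiff 1 g) := by
      ext n
      simp only [fwdDiff, Pi.mul_apply, Pi.add_apply]
      ring
    rw [Function.iterate_succ_apply, key, fwdDiff_iter_add, fwdDiff_iter_add]
    refine dvd_add ?_ (dvd_add ?_ ?_)
    · exact (pow_dvd_pow q (by omega)).trans (ih hf.succ hg n)
    · exact (pow_dvd_pow q (by omega)).trans (ih hf hg.succ n)
    · exact (pow_dvd_pow q (by omega)).trans (ih hf.succ hg.succ n)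

theorem const (c : R) : HasDivisibleDiffs q 0 (fun _ => c) := by
  rintro (_ | k) n
  · simp
  · rw [Function.iterate_succ_apply, fwdDiff_const]
    exact zero (q := q) (a := 0 + (k + 1)) k n |> (pow_dvd_pow q (by omega)).trans

theorem pow (hf : HasDivisibleDiffs q 0 f) (n : ℕ) : HasDivisibleDiffs q 0 (f ^ n) := by
  induction n with
  | zero => rw [pow_zero]; exact const (1 : R)
  | succ n ih => rw [pow_succ]; exact ih.mul hf

theorem mul_natCast (c : R) : HasDivisibleDiffs q 0 (fun n => q * c * n) := by
  rintro (_ | k) n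
  · simp
  · have h : fwdDiff 1 (fun n : ℕ => q * c * n) = (fun _ => q) * fun _ => c := by
      ext n
      simp [fwdDiff]
      ring
    have hq : HasDivisibleDiffs q 1 (fun _ : ℕ => q) := by
      rintro (_ | k) n
      · simp
      · rw [Function.iterate_succ_apply, fwdDiff_const]
        exact (pow_dvd_pow q (by omega)).trans (zero (q := q) (a := 1 + (k + 1)) k n)
    rw [Function.iterate_succ_apply, h]
    exact (pow_dvd_pow q (by omega)).trans (hq.mul (const c) k n)

theorem one_add_mul_pow (c : R) : HasDivisibleDiffs q 0 (fun n => (1 + q * c) ^ n) := by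
  intro k n
  have h : (fwdDiff 1)^[k] (fun n => (1 + q * c) ^ n) = fun n => (q * c) ^ k * (1 + q * c) ^ n := by
    induction k with
    | zero => simp
    | succ k ih =>
      rw [Function.iterate_succ_apply', ih]
      ext n
      simp only [fwdDiff]
      ring
  rw [h, zero_add]
  exact (pow_dvd_pow_of_dvd (dvd_mul_right q c) k).mul_right _

open Polynomial in
theorem polynomial_eval (P : R[X]) (hf : HasDivisibleDiffs q 0 f) :
    HasDivisibleDiffs q 0 (fun n => P.eval (f n)) := by
  have : (fun n => P.eval (f n)) =
      ∑ i ∈ Finset.range (P.natDegree + 1), (fun _ => P.coeff i) * f ^ i := by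
    ext n
    simp [eval_eq_sum_range]
  rw [this]
  exact sum _ _ fun i _ => (const _).mul (hf.pow i)

open Polynomial in
/-- A function with differences divisible by powers of `p ^ 2` agrees on any initial segment,
up to a factor prime to `p`, with a polynomial whose coefficients tend to zero `p`-adically
at a uniform rate. -/
theorem exists_polynomial [IsDomain R] {p : ℕ} (hp : p.Prime)
    (hf : HasDivisibleDiffs ((p : R) ^ 2) 0 f) (L : ℕ) :
    ∃ (u : ℕ) (P : R[X]), u.Coprime p ∧ (∀ j, (p : R) ^ j ∣ P.coeff j) ∧
      ∀ n ≤ L, P.eval (n : R) = u * f n := by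
  have := Fact.mk hp
  have he (k : ℕ) (hk : k ≤ L) : ∃ e : ℕ,
      e * k.factorial = p ^ k * (L.factorial / p ^ (L.factorial).factorization p) := by
    obtain ⟨w, hw⟩ := Nat.ordCompl_dvd_ordCompl_of_dvd (Nat.factorial_dvd_factorial hk) p
    have hv : (k.factorial).factorization p ≤ k := by
      rw [Nat.factorization_def _ hp]
      exact padicValNat_factorial_le p k
    refine ⟨p ^ (k - (k.factorial).factorization p) * w, ?_⟩
    have hk' := Nat.ordProj_mul_ordCompl_eq_self k.factorial p
    have hpk := pow_sub_mul_pow p hv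
    rw [hw]
    generalize k.factorial / p ^ k.factorial.factorization p = c at hk' ⊢
    rw [← hpk]
    calc _ = p ^ (k - (k.factorial).factorization p) * w *
          (p ^ (k.factorial).factorization p * c) := by rw [hk']
      _ = _ := by ring
  choose! e he using he
  choose d hd using fun k => hf k 0
  refine ⟨_, ∑ k ∈ Finset.range (L + 1),
    C ((p : R) ^ k * e k * d k) * (descPochhammer R k),
    (Nat.coprime_ordCompl hp (Nat.factorial_ne_zero L)).symm, fun j => ?_, fun n hn => ?_⟩
  · rw [finsetSum_coeff]
    refine Finset.dvd_sum fun k _ => ?_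
    rw [coeff_C_mul]
    rcases lt_or_ge k j with h | h
    · rw [coeff_eq_zero_of_natDegree_lt, mul_zero]
      · exact dvd_zero _
      · rwa [descPochhammer_natDegree]
    · rw [mul_assoc, mul_assoc]
      exact (pow_dvd_pow _ h).mul_right _
  · have h := shift_eq_sum_fwdDiff_iter (1 : ℕ) f n 0
    simp only [smul_eq_mul, mul_one, zero_add] at h
    rw [eval_finsetSum, h, Finset.mul_sum]
    rw [← Finset.sum_subset (Finset.range_subset_range.mpr (Nat.succ_le_succ hn))]
    · refine Finset.sum_congr rfl fun k hk => ?_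
      have hk : k ≤ L := by have := Finset.mem_range.mp hk; omega
      have h1 : (e k : R) * k.factorial =
          (p : R) ^ k * (L.factorial / p ^ (L.factorial).factorization p : ℕ) := by
        exact_mod_cast congrArg (Nat.cast (R := R)) (he k hk)
      rw [eval_mul, eval_C, descPochhammer_eval_eq_descFactorial,
        Nat.descFactorial_eq_factorial_mul_choose, hd]
      push_cast at h1 ⊢
      rw [nsmul_eq_mul]
      linear_combination (p : R) ^ k * d k * n.choose k * h1
    · intro k _ hk
      rw [eval_mul, descPochhammer_eval_eq_descFactorial,
        Nat.descFactorial_of_lt (by simpa using hk)]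
      simp

/-- The `p`-adic identity theorem: such a function vanishes identically
as soon as it has infinitely many zeros. -/
theorem eq_zero_of_infinite [IsDomain R] [CharZero R] {p : ℕ} (hp : p.Prime)
    (hR : ∀ x : R, (∀ k : ℕ, (p : R) ^ k ∣ x) → x = 0)
    (hf : HasDivisibleDiffs ((p : R) ^ 2) 0 f) (hinf : {n | f n = 0}.Infinite) (m : ℕ) :
    f m = 0 := by
  refine hR _ fun k => ?_
  obtain ⟨A, hA, rfl⟩ := hinf.exists_subset_card_eq k
  obtain ⟨u, P, hu, hP, hPf⟩ := hf.exists_polynomial hp (A.sup id + m)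
  have h := P.pow_dvd_eval_of_roots (p : R) (A.map Nat.castEmbedding) 0 hP (by
    simp only [Finset.mem_map, forall_exists_index, and_imp]
    rintro _ a ha rfl
    have h0 : f a = 0 := hA ha
    have : a ≤ A.sup id := Finset.le_sup (f := id) ha
    rw [Nat.castEmbedding_apply, hPf a (by omega), h0, mul_zero]) m
  rw [hPf m (by omega), zero_add, Finset.card_map] at h
  refine IsCoprime.dvd_of_dvd_mul_left (IsCoprime.pow_left ?_) h
  have := (Nat.isCoprime_iff_coprime.mpr hu.symm).map (Int.castRingHom R)
  simpa using this

end HasDivisibleDiffs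

/-- A unit which is integral over `ℤ` modulo a prime `p` has finite order modulo `p`. -/
theorem exists_pow_sub_one_dvd_of_isIntegral {R : Type*} [CommRing R] {p : ℕ} (hp : p ≠ 0)
    {x : R} (hx : IsUnit x)
    (hint : IsIntegral ℤ (Ideal.Quotient.mk (Ideal.span {(p : R)}) x)) :
    ∃ N : ℕ, 0 < N ∧ (p : R) ∣ x ^ N - 1 := by
  set π := Ideal.Quotient.mk (Ideal.span {(p : R)})
  have hpπ : π p = 0 := Ideal.Quotient.eq_zero_iff_mem.mpr (Ideal.mem_span_singleton_self _)
  have : Module.Finite ℤ (Algebra.adjoin ℤ {π x}) :=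
    Module.Finite.iff_fg.mpr hint.fg_adjoin_singleton
  have : Finite (Algebra.adjoin ℤ {π x}) := by
    refine Module.finite_of_fg_torsion _ fun y => ?_
    refine ⟨⟨(p : ℤ), mem_nonZeroDivisors_of_ne_zero (by exact_mod_cast hp)⟩, ?_⟩
    apply Subtype.ext
    change ((p : ℤ) • (y : R ⧸ Ideal.span {(p : R)})) = 0
    rw [zsmul_eq_mul]
    have : ((p : ℤ) : R ⧸ Ideal.span {(p : R)}) = π p := by simp
    rw [this, hpπ, zero_mul]
  obtain ⟨m, n, hmn, h⟩ := Finite.exists_ne_map_eq_of_infinite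
    fun n : ℕ => (⟨π x, Algebra.self_mem_adjoin_singleton ℤ _⟩ : Algebra.adjoin ℤ {π x}) ^ n
  replace h : π x ^ m = π x ^ n := congrArg Subtype.val h
  wlog hlt : m < n generalizing m n
  · exact this n m hmn.symm h.symm (by omega)
  refine ⟨n - m, by omega, ?_⟩
  rw [← Ideal.mem_span_singleton, ← Ideal.Quotient.eq_zero_iff_mem]
  change π _ = 0
  have h1 : π x ^ m * π (x ^ (n - m) - 1) = 0 := by
    simp only [map_sub, map_pow, map_one]
    rw [mul_sub, ← pow_add, Nat.add_sub_cancel' hlt.le, h, mul_one, sub_self]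
  exact ((hx.map π).pow m).mul_right_eq_zero.mp h1

open MvPolynomial in
/-- Algebraic independence over `ℤ` is preserved by rational translations and rescalings. -/
theorem AlgebraicIndependent.sub_div_int {K ι : Type*} [Field K] [CharZero K] {t : ι → K}
    (ht : AlgebraicIndependent ℤ t) (c : ι → ℤ) {p : ℕ} (hp : p ≠ 0) :
    AlgebraicIndependent ℤ (fun i => (t i - c i) / p) := by
  have : Algebra.IsAlgebraic ℤ ℚ := IsLocalization.isAlgebraic ℚ (nonZeroDivisors ℤ)
  have ht' : AlgebraicIndependent ℚ t := ht.extendScalars ℚ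
  have hp' : (p : ℚ) ≠ 0 := by exact_mod_cast hp
  let φ : MvPolynomial ι ℚ →ₐ[ℚ] MvPolynomial ι ℚ :=
    aeval fun i => C (p : ℚ)⁻¹ * (X i - C (c i : ℚ))
  let ψ : MvPolynomial ι ℚ →ₐ[ℚ] MvPolynomial ι ℚ :=
    aeval fun i => C (p : ℚ) * X i + C (c i : ℚ)
  have hψφ : ψ.comp φ = AlgHom.id ℚ _ := by
    refine algHom_ext fun i => ?_
    simp only [φ, ψ, AlgHom.comp_apply, aeval_X, map_mul, map_sub, algHom_C, algebraMap_eq,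
      AlgHom.id_apply, add_sub_cancel_right]
    rw [← mul_assoc, ← C_mul, inv_mul_cancel₀ hp', C_1, one_mul]
  have hφ : Function.Injective φ := Function.LeftInverse.injective (g := ψ)
    fun P => DFunLike.congr_fun hψφ P
  have h : AlgebraicIndependent ℚ (fun i => (t i - c i) / p) := by
    have : (aeval fun i => (t i - c i) / p : MvPolynomial ι ℚ →ₐ[ℚ] K) = (aeval t).comp φ := by
      refine algHom_ext fun i => ?_
      simp [φ, div_eq_inv_mul]
    rw [AlgebraicIndependent, this]
    exact Function.Injective.comp (g := aeval t) ht' hφ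
  exact h.restrictScalars (algebraMap ℤ ℚ).injective_int

open MvPolynomial in
/-- A prime is not invertible in a subring generated by algebraically independent elements. -/
theorem AlgebraicIndependent.not_isUnit_natCast_adjoin {K ι : Type*} [Field K] {s : ι → K}
    (hs : AlgebraicIndependent ℤ s) {p : ℕ} (hp : p.Prime) :
    ¬ IsUnit (p : Algebra.adjoin ℤ (Set.range s)) := by
  intro h
  have h := (h.map hs.aevalEquiv.symm).map (constantCoeff (R := ℤ) (σ := ι))
  rw [map_natCast, map_natCast] at h
  exact (Nat.prime_iff_prime_int.mp hp).not_isUnit h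

open MvPolynomial in
theorem MvPolynomial.exists_eval_ne_zero {σ : Type*} {P : MvPolynomial σ ℤ} (hP : P ≠ 0) :
    ∃ c : σ → ℤ, eval c P ≠ 0 := by
  contrapose! hP
  exact MvPolynomial.funext fun c => by simpa using hP c

open MvPolynomial in
theorem MvPolynomial.mk_comp_aeval_eq {σ S : Type*} [CommRing S] (J : Ideal S) {t : σ → S}
    {c : σ → ℤ} (h : ∀ i, t i - c i ∈ J) :
    (Ideal.Quotient.mk J).comp ((aeval t : _ →ₐ[ℤ] S) : MvPolynomial σ ℤ →+* S) =
      (algebraMap ℤ (S ⧸ J)).comp (eval c) := by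
  refine ringHom_ext (fun n => by simp) fun i => ?_
  have := Ideal.Quotient.eq.mpr (h i)
  simpa using this

open MvPolynomial in
/-- Every finite subset of a field of characteristic zero lies in a subring which is
`p`-adically separated for some prime `p`, and in which the elements of the given set become
integral over `ℤ` modulo `p`. -/
theorem exists_subalgebra_isIntegral_mod_prime {K : Type*} [Field K] [CharZero K] {T : Set K}
    (hT : T.Finite) : ∃ (R : Subalgebra ℤ K) (p : ℕ), p.Prime ∧ T ⊆ R ∧
      (∀ x : R, (∀ k : ℕ, (p : R) ^ k ∣ x) → x = 0) ∧
      ∀ x : R, (x : K) ∈ T → IsIntegral ℤ (Ideal.Quotient.mk (Ideal.span {(p : R)}) x) := by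
  classical
  obtain ⟨I, hI⟩ := (AlgebraicIndependent.matroid ℤ K).exists_isBasis T
  obtain ⟨hind, hIT, halg⟩ := AlgebraicIndependent.matroid_isBasis_iff.mp hI
  have hIfin : Finite I := hT.subset hIT
  let t : I → K := Subtype.val
  have ht : AlgebraicIndependent ℤ t := hind
  -- clear denominators
  have hmul : ∀ x ∈ T, ∃ y : MvPolynomial I ℤ, y ≠ 0 ∧
      ((aeval t : _ →ₐ[ℤ] K) : MvPolynomial I ℤ →+* K).IsIntegralElem (aeval t y * x) := by
    intro x hx
    have hr : Set.range t = I := Subtype.range_val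
    have hx := halg x hx
    rw [← hr] at hx
    obtain ⟨y, hy, P, hP, hPx⟩ := hx.exists_integral_multiple
    refine ⟨ht.aevalEquiv.symm y, by simpa using hy,
      P.map (ht.aevalEquiv.symm : _ →+* MvPolynomial I ℤ), hP.map _, ?_⟩
    have h (z) : aeval t (ht.aevalEquiv.symm z) = (z : K) := by
      rw [← ht.algebraMap_aevalEquiv, AlgEquiv.apply_symm_apply]
      rfl
    have h' : ((aeval t : _ →ₐ[ℤ] K) : MvPolynomial I ℤ →+* K).comp
        (ht.aevalEquiv.symm : _ →+* MvPolynomial I ℤ) = algebraMap _ K :=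
      RingHom.ext fun z => h z
    rw [Polynomial.eval₂_map, h', h]
    exact hPx
  choose! y hy hyx using hmul
  obtain ⟨c, hc⟩ := exists_eval_ne_zero
    (Finset.prod_ne_zero_iff.mpr fun x hx => hy x (hT.mem_toFinset.mp hx))
  obtain ⟨p, hpc, hp⟩ := Nat.exists_infinite_primes
    ((eval c (∏ x ∈ hT.toFinset, y x)).natAbs + 1)
  have hcop : ∀ x ∈ T, IsCoprime (eval c (y x)) p := by
    intro x hx
    rw [isCoprime_comm, (Nat.prime_iff_prime_int.mp hp).coprime_iff_not_dvd]
    intro h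
    have h := h.trans (map_dvd (eval c) (Finset.dvd_prod_of_mem y (hT.mem_toFinset.mpr hx)))
    have := Nat.le_of_dvd (Int.natAbs_pos.mpr hc) (Int.natCast_dvd.mp h)
    omega
  let s : I → K := fun i => (t i - c i) / p
  have hs : AlgebraicIndependent ℤ s := ht.sub_div_int c hp.ne_zero
  have hts : ∀ i, t i = c i + p * s i := by
    intro i
    have : (p : K) ≠ 0 := by exact_mod_cast hp.ne_zero
    simp only [s]
    field_simp
    ring
  let A := Algebra.adjoin ℤ (Set.range s)
  obtain ⟨V, hAV, hpV⟩ := Ideal.image_subset_nonunits_valuationSubring (A := A.toSubring)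
    (Ideal.span {(p : A.toSubring)}) (by
      rw [Ne, Ideal.span_singleton_eq_top]
      exact hs.not_isUnit_natCast_adjoin hp)
  have hpV : (p : K) ∈ V.nonunits := hpV ⟨p, Ideal.mem_span_singleton_self _, by simp⟩
  have hsV : ∀ i, s i ∈ V := fun i => hAV (Algebra.subset_adjoin ⟨i, rfl⟩)
  have htV : ∀ i, t i ∈ V := fun i => by
    rw [hts]
    exact add_mem (intCast_mem _ _) (mul_mem (natCast_mem _ _) (hsV i))
  let R := Algebra.adjoin ℤ (Set.range s ∪ T)
  have hsR : ∀ i, s i ∈ R := fun i => Algebra.subset_adjoin (Or.inl ⟨i, rfl⟩)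
  have hTR : T ⊆ R := fun x hx => Algebra.subset_adjoin (Or.inr hx)
  let tR : I → R := fun i => ⟨t i, hTR (hIT i.2)⟩
  have htR : ((aeval t : _ →ₐ[ℤ] K) : MvPolynomial I ℤ →+* K) =
      (algebraMap R K).comp ((aeval tR : _ →ₐ[ℤ] R) : MvPolynomial I ℤ →+* R) := by
    refine ringHom_ext (fun n => by simp) fun i => ?_
    simp only [RingHom.coe_coe, aeval_X, RingHom.comp_apply]
    rfl
  have hmod := mk_comp_aeval_eq (Ideal.span {(p : R)}) (t := tR) (c := c) fun i =>
    Ideal.mem_span_singleton.mpr ⟨⟨s i, hsR i⟩, Subtype.ext (by simp [tR, hts])⟩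
  have hpV' : (p : V) ∈ IsLocalRing.maximalIdeal V :=
    ValuationSubring.coe_mem_nonunits_iff.mp (by simpa using hpV)
  have hTV : T ⊆ V := by
    intro x hx
    let tV : I → V := fun i => ⟨t i, htV i⟩
    have htV' : ((aeval t : _ →ₐ[ℤ] K) : MvPolynomial I ℤ →+* K) =
        (algebraMap V K).comp ((aeval tV : _ →ₐ[ℤ] V) : MvPolynomial I ℤ →+* V) := by
      refine ringHom_ext (fun n => by simp) fun i => ?_
      simp only [RingHom.coe_coe, aeval_X, RingHom.comp_apply]
      rfl
    have hmodV := mk_comp_aeval_eq (IsLocalRing.maximalIdeal V) (t := tV) (c := c) fun i => by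
      have : tV i - c i = p * ⟨s i, hsV i⟩ := Subtype.ext (by simp [tV, hts])
      rw [this]
      exact Ideal.mul_mem_right _ _ hpV'
    have hunit : IsUnit (aeval tV (y x)) := by
      by_contra hnot
      have h := DFunLike.congr_fun hmodV (y x)
      have h0 : Ideal.Quotient.mk (IsLocalRing.maximalIdeal V) (aeval tV (y x)) = 0 :=
        Ideal.Quotient.eq_zero_iff_mem.mpr hnot
      have hp0 := Ideal.Quotient.eq_zero_iff_mem.mpr hpV'
      obtain ⟨a, b, hab⟩ := hcop x hx
      have hab := congrArg (algebraMap ℤ (V ⧸ IsLocalRing.maximalIdeal V)) hab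
      simp only [RingHom.comp_apply, RingHom.coe_coe] at h
      rw [map_natCast] at hp0
      rw [map_add, map_mul, map_mul, ← h, h0, map_natCast, hp0, map_one] at hab
      simp at hab
    have hint := hyx x hx
    rw [htV'] at hint
    obtain ⟨z, hz⟩ := (IsIntegrallyClosed.isIntegral_iff (R := V) (K := K)).mp hint.of_comp
    obtain ⟨w, hw⟩ := hunit.exists_left_inv
    have : x = ((w * z : V) : K) := by
      have hw' : (w : K) * (aeval tV (y x) : V) = 1 := congrArg Subtype.val hw
      have h1 : aeval t (y x) = ((aeval tV (y x) : V) : K) := DFunLike.congr_fun htV' (y x)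
      have hz' : (z : K) = aeval t (y x) * x := hz
      push_cast
      rw [hz', h1, ← mul_assoc, hw', one_mul]
    rw [this]
    exact (w * z).2
  have hRV : ∀ x ∈ R, x ∈ V := by
    intro x hx
    have : R ≤ subalgebraOfSubring V.toSubring := Algebra.adjoin_le (by
      rintro _ (⟨i, rfl⟩ | hx)
      · exact hsV i
      · exact hTV hx)
    exact this hx
  have hpR : ¬ IsUnit (p : R) := by
    intro h
    obtain ⟨q, hq⟩ := h.exists_right_inv
    refine hpV' (IsUnit.of_mul_eq_one ⟨q, hRV q q.2⟩ (Subtype.ext ?_))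
    simpa using congrArg Subtype.val hq
  have : IsNoetherianRing R := by
    have hfin : (Set.range s ∪ T).Finite := (Set.finite_range s).union hT
    exact isNoetherianRing_of_fg ⟨hfin.toFinset, by rw [hfin.coe_toFinset]⟩
  refine ⟨R, p, hp, hTR, fun x hx => ?_, fun x hx => ?_⟩
  · have h := Ideal.iInf_pow_eq_bot_of_isDomain (Ideal.span {(p : R)})
      (by rwa [Ne, Ideal.span_singleton_eq_top])
    rw [← Ideal.mem_bot, ← h, Ideal.mem_iInf]
    intro k
    rw [Ideal.span_singleton_pow, Ideal.mem_span_singleton]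
    exact hx k
  · have h := hyx _ hx
    rw [htR] at h
    have hyR : aeval t (y x) = algebraMap R K (aeval tR (y x)) := DFunLike.congr_fun htR (y x)
    have h := (RingHom.IsIntegralElem.of_map (x := aeval tR (y x) * x)
      (FaithfulSMul.algebraMap_injective R K) (by rwa [map_mul, ← hyR])).map
      (Ideal.Quotient.mk (Ideal.span {(p : R)}))
    rw [hmod] at h
    obtain ⟨a, b, hab⟩ := hcop _ hx
    have hab := congrArg (algebraMap ℤ (R ⧸ Ideal.span {(p : R)})) hab
    have hp0 : (p : R ⧸ Ideal.span {(p : R)}) = 0 := by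
      rw [← map_natCast (Ideal.Quotient.mk _), Ideal.Quotient.eq_zero_iff_mem]
      exact Ideal.mem_span_singleton_self _
    have hyc := DFunLike.congr_fun hmod (y x)
    simp only [RingHom.comp_apply, RingHom.coe_coe] at hyc
    have hint : IsIntegral ℤ (algebraMap ℤ _ a *
        Ideal.Quotient.mk (Ideal.span {(p : R)}) (aeval tR (y x) * x)) :=
      isIntegral_algebraMap.mul h.of_comp
    rw [map_add, map_mul, map_mul, map_natCast, hp0, mul_zero, add_zero, map_one, ← hyc] at hab
    rwa [map_mul, ← mul_assoc, hab, one_mul] at hint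

open Polynomial in
/-- Exponential monomials with distinct nonzero bases are linearly independent
over the polynomials. -/
theorem Polynomial.eq_zero_of_sum_eval_mul_pow_eq_zero {K ι : Type*} [Field K] [CharZero K]
    [Fintype ι] {μ : ι → K} (hμ : Function.Injective μ) (hμ0 : ∀ j, μ j ≠ 0) (P : ι → K[X])
    (h : ∀ n : ℕ, ∑ j, (P j).eval (n : K) * μ j ^ n = 0) (j : ι) : P j = 0 := by
  classical
  let E : Module.End K (ℕ → K) := LinearMap.funLeft K K (· + 1)
  have hmem : ∀ (d : ℕ) (c : K) (Q : K[X]), Q.natDegree < d →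
      ((E - c • 1) ^ d) (fun n : ℕ => Q.eval (n : K) * c ^ n) = 0 := by
    intro d c
    have hiter : ∀ (d : ℕ) (f : K → K), ((E - c • 1) ^ d) (fun n : ℕ => f n * c ^ n) =
        fun n : ℕ => c ^ d * (fwdDiff 1)^[d] f n * c ^ n := by
      intro d
      induction d with
      | zero => simp
      | succ d ih =>
        intro f
        have : (E - c • 1) (fun n : ℕ => f n * c ^ n) =
            fun n : ℕ => (c • fwdDiff 1 f) n * c ^ n := by
          ext n
          simp [E, LinearMap.funLeft_apply, fwdDiff]
          ring
        rw [pow_succ, Module.End.mul_apply, this, ih, Function.iterate_succ_apply,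
          fwdDiff_iter_const_smul]
        ext n
        simp only [Pi.smul_apply, smul_eq_mul]
        ring
    intro Q hQ
    rw [hiter d (fun x => Q.eval x), fwdDiff_iter_eq_zero_of_degree_lt hQ]
    ext n
    simp
  have hind := E.independent_maxGenEigenspace.comp hμ
  have hz := (iSupIndep_iff_finsetSum_eq_zero_imp_eq_zero _).mp hind Finset.univ
    (fun j n => (P j).eval (n : K) * μ j ^ n)
    (fun j _ => (Module.End.mem_maxGenEigenspace _ _ _).mpr
      ⟨_, hmem _ (μ j) (P j) (Nat.lt_succ_self _)⟩)
    (by ext n; simpa using h n) j (Finset.mem_univ j)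
  refine eq_zero_of_infinite_isRoot _
    ((Set.infinite_range_of_injective (Nat.cast_injective (R := K))).mono ?_)
  rintro _ ⟨n, rfl⟩
  exact (mul_eq_zero.mp (congrFun hz n)).resolve_right (pow_ne_zero _ (hμ0 j))

open Polynomial in
/-- The values of an exponential polynomial on each residue class to a suitable modulus
are all zero as soon as infinitely many of them are. -/
theorem exists_modulus_eq_zero_of_infinite {K ι : Type*} [Field K] [CharZero K] [Fintype ι]
    {μ : ι → K} (hμ0 : ∀ j, μ j ≠ 0) (P : ι → K[X]) :
    ∃ b : ℕ, 0 < b ∧ ∀ r : ℕ,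
      {n : ℕ | ∑ j, (P j).eval ((r + b * n : ℕ) : K) * μ j ^ (r + b * n) = 0}.Infinite →
      ∀ n : ℕ, ∑ j, (P j).eval ((r + b * n : ℕ) : K) * μ j ^ (r + b * n) = 0 := by
  classical
  obtain ⟨R, p, hp, hTR, hsep, hint⟩ := exists_subalgebra_isIntegral_mod_prime (K := K)
    (((Set.finite_range μ).union (Set.finite_range fun j => (μ j)⁻¹)).union
      (Set.finite_iUnion fun j => (P j).coeffs.finite_toSet))
  have hμR (j) : μ j ∈ R := hTR (Or.inl (Or.inl ⟨j, rfl⟩))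
  have hinvR (j) : (μ j)⁻¹ ∈ R := hTR (Or.inl (Or.inr ⟨j, rfl⟩))
  let ν : ι → R := fun j => ⟨μ j, hμR j⟩
  have hlift (j) : ∃ Q : R[X], Q.map (algebraMap R K) = P j := by
    refine (mem_lifts _).mp ((lifts_iff_coeff_lifts _).mpr fun n => ?_)
    by_cases h0 : (P j).coeff n = 0
    · exact ⟨0, by rw [h0, map_zero]⟩
    · exact ⟨⟨_, hTR (Or.inr (Set.mem_iUnion.mpr ⟨j, coeff_mem_coeffs h0⟩))⟩, rfl⟩
  choose Q hQ using hlift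
  have hN (j) : ∃ N : ℕ, 0 < N ∧ (p : R) ∣ ν j ^ N - 1 :=
    exists_pow_sub_one_dvd_of_isIntegral hp.ne_zero
      (IsUnit.of_mul_eq_one ⟨_, hinvR j⟩ (Subtype.ext (mul_inv_cancel₀ (hμ0 j))))
      (hint _ (Or.inl (Or.inl ⟨j, rfl⟩)))
  choose N hN0 hN using hN
  have hb (j) : ∃ c : R, ν j ^ ((∏ i, N i) * p ^ 2) = 1 + (p : R) ^ 2 * c := by
    obtain ⟨M, hM⟩ := Finset.dvd_prod_of_mem N (Finset.mem_univ j)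
    have h : (p : R) ∣ ν j ^ (∏ i, N i) - 1 := by
      rw [hM, pow_mul]
      exact (hN j).trans (sub_one_dvd_pow_sub_one _ _)
    obtain ⟨c, hc⟩ := (pow_dvd_pow (p : R) (Nat.le_succ 2)).trans
      (dvd_sub_pow_of_dvd_sub h 2)
    refine ⟨c, ?_⟩
    rw [← hc, pow_mul, one_pow, add_sub_cancel]
  choose c hc using hb
  refine ⟨(∏ i, N i) * p ^ 2, Nat.mul_pos (Finset.prod_pos fun i _ => hN0 i)
    (pow_pos hp.pos 2), fun r => ?_⟩
  let f : ℕ → R := ∑ j, (fun n : ℕ => (Q j).eval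
    (((fun _ => (r : R)) + (fun n : ℕ => (p : R) ^ 2 * (∏ i, N i : ℕ) * n) : ℕ → R) n)) *
      ((fun _ => ν j ^ r) * fun n => (1 + (p : R) ^ 2 * c j) ^ n)
  have hf : HasDivisibleDiffs ((p : R) ^ 2) 0 f := .sum _ _ fun j _ =>
    (HasDivisibleDiffs.polynomial_eval (Q j) ((HasDivisibleDiffs.const _).add
      (.mul_natCast _))).mul ((HasDivisibleDiffs.const _).mul (.one_add_mul_pow _))
  have hfK (n : ℕ) : ∑ j, (P j).eval ((r + (∏ i, N i) * p ^ 2 * n : ℕ) : K) *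
      μ j ^ (r + (∏ i, N i) * p ^ 2 * n) = algebraMap R K (f n) := by
    simp only [f, Finset.sum_apply, map_sum]
    refine Finset.sum_congr rfl fun j _ => ?_
    simp only [Pi.mul_apply, Pi.add_apply]
    rw [map_mul, ← hc, ← pow_mul, ← pow_add, map_pow]
    congr 1
    rw [← hQ, eval_map_algebraMap, ← aeval_algebraMap_apply_eq_algebraMap_eval]
    congr 2
    push_cast
    ring
  have hinj := FaithfulSMul.algebraMap_injective R K
  simp only [hfK, map_eq_zero_iff _ hinj]
  exact fun hinf => hf.eq_zero_of_infinite hp hsep hinf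

/-- A set of natural numbers whose trace on each residue class modulo `b` is either finite
or everything is the union of a finite set and finitely many arithmetic progressions. -/
theorem Set.exists_eq_union_arithmetic_progressions {b : ℕ} (hb : 0 < b) {S : Set ℕ}
    (h : ∀ r, {n | r + b * n ∈ S}.Infinite → ∀ n, r + b * n ∈ S) :
    ∃ (F : Finset ℕ) (k : ℕ) (a d : Fin k → ℕ), (∀ i, 1 ≤ d i) ∧
      S = ↑F ∪ ⋃ i, {x : ℕ | ∃ m : ℕ, x = a i + m * d i} := by
  classical
  let G : Finset ℕ := (Finset.range b).filter fun r => {n | r + b * n ∈ S}.Infinite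
  have hfin : (⋃ r ∈ (Finset.range b).filter fun r => {n | r + b * n ∈ S}.Finite,
      (fun n => r + b * n) '' {n | r + b * n ∈ S}).Finite :=
    Set.Finite.biUnion (Finset.finite_toSet _) fun r hr => (Finset.mem_filter.mp hr).2.image _
  refine ⟨hfin.toFinset, G.card, fun i => G.equivFin.symm i, fun _ => b, fun _ => hb, ?_⟩
  ext x
  simp only [Set.Finite.coe_toFinset, Set.mem_union, Set.mem_iUnion, Set.mem_image,
    Set.mem_ofPred_eq, Finset.mem_filter, Finset.mem_range, exists_prop]
  constructor
  · intro hx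
    have hxr : x % b + b * (x / b) = x := Nat.mod_add_div x b
    by_cases hr : {n | x % b + b * n ∈ S}.Finite
    · exact Or.inl ⟨x % b, ⟨Nat.mod_lt x hb, hr⟩, x / b, by rwa [hxr], hxr⟩
    · have hG : x % b ∈ G := Finset.mem_filter.mpr ⟨Finset.mem_range.mpr (Nat.mod_lt x hb), hr⟩
      refine Or.inr ⟨G.equivFin ⟨_, hG⟩, x / b, ?_⟩
      rw [Equiv.symm_apply_apply, mul_comm]
      exact hxr.symm
  · rintro (⟨r, _, n, hn, rfl⟩ | ⟨i, m, rfl⟩)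
    · exact hn
    · rw [mul_comm]
      exact h _ (Finset.mem_filter.mp (G.equivFin.symm i).2).2 m

/-- **The Skolem–Mahler–Lech theorem.** For distinct nonzero `λ₁, …, λ_l ∈ ℂ`
and polynomials `p₁, …, p_l ∈ ℂ[x]`, the zero set of
`u_n = Σ_j p_j(n) λ_jⁿ` is the union of a finite set and finitely many infinite
arithmetic progressions; moreover, if no ratio `λ_i/λ_j` (`i ≠ j`) is a root of
unity and the `p_j` are not all zero, the zero set is finite. -/
theorem skolem_mahler_lech
    (l : ℕ) (lam : Fin l → ℂ) (p : Fin l → Polynomial ℂ)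
    (hdist : Function.Injective lam) (hne : ∀ j, lam j ≠ 0) :
    (∃ (F : Finset ℕ) (k : ℕ) (a b : Fin k → ℕ), (∀ i, 1 ≤ b i) ∧
      {n : ℕ | ∑ j, (p j).eval (n : ℂ) * lam j ^ n = 0}
        = ↑F ∪ ⋃ i, {x : ℕ | ∃ m : ℕ, x = a i + m * b i}) ∧
    ((∀ i j, i ≠ j → ∀ r : ℕ, 0 < r → (lam i / lam j) ^ r ≠ 1) →
      (∃ j, p j ≠ 0) →
      {n : ℕ | ∑ j, (p j).eval (n : ℂ) * lam j ^ n = 0}.Finite) := by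
  obtain ⟨b, hb, h⟩ := exists_modulus_eq_zero_of_infinite hne p
  refine ⟨Set.exists_eq_union_arithmetic_progressions hb h, fun hnd ⟨j, hj⟩ => ?_⟩
  by_contra hinf
  obtain ⟨r, hr⟩ : ∃ r, {n | r + b * n ∈
      {n : ℕ | ∑ j, (p j).eval (n : ℂ) * lam j ^ n = 0}}.Infinite := by
    by_contra! hfin
    refine hinf (((Set.finite_Iio b).biUnion fun r _ =>
      (hfin r).image fun n => r + b * n).subset fun x hx => ?_)
    have hxr : x % b + b * (x / b) = x := Nat.mod_add_div x b
    exact Set.mem_biUnion (Nat.mod_lt x hb) ⟨x / b, by rwa [Set.mem_ofPred_eq, hxr], hxr⟩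
  have hzero := h r hr
  have hinj : Function.Injective fun j => lam j ^ b := by
    intro i j hij
    by_contra hne'
    refine hnd i j hne' b hb ?_
    rw [div_pow, div_eq_one_iff_eq (pow_ne_zero _ (hne j))]
    exact hij
  let L : Polynomial ℂ := Polynomial.C (b : ℂ) * Polynomial.X + Polynomial.C (r : ℂ)
  have hP := Polynomial.eq_zero_of_sum_eval_mul_pow_eq_zero hinj
    (fun j => pow_ne_zero _ (hne j)) (fun j => Polynomial.C (lam j ^ r) * (p j).comp L)
    (fun n => by
      rw [← hzero n]
      refine Finset.sum_congr rfl fun j _ => ?_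
      simp only [L, Polynomial.eval_mul, Polynomial.eval_C, Polynomial.eval_comp,
        Polynomial.eval_add, Polynomial.eval_X, pow_add, pow_mul]
      push_cast
      rw [add_comm (r : ℂ)]
      ring) j
  have hbC : (b : ℂ) ≠ 0 := by exact_mod_cast hb.ne'
  rcases mul_eq_zero.mp hP with h0 | h0
  · exact pow_ne_zero r (hne j) (Polynomial.C_eq_zero.mp h0)
  · have hL : L.natDegree = 1 := Polynomial.natDegree_linear hbC
    rcases Polynomial.comp_eq_zero_iff.mp h0 with h1 | ⟨-, h1⟩
    · exact hj h1
    · rw [h1, Polynomial.natDegree_C] at hL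
      exact zero_ne_one hL
end

section
/- Let A be a d×d real matrix, a ∈ ℝ^d, B a k×d real matrix, and c ∈ ℝ^k; let f : ℝ^d → ℝ^d be the affine map f(x) = Ax + a and P = {x ∈ ℝ^d : Bx ≥ c componentwise}. Then both the set of non-terminating points NT = {u ∈ ℝ^d : ∀n ∈ ℕ, fⁿ(u) ∈ P} and the set of eventually non-terminating points ENT = {u ∈ ℝ^d : ∃n ∈ ℕ, fⁿ(u) ∈ NT} are convex subsets of ℝ^d. -/
theorem AffineMap.convex_iterate_preimage {E : Type*} [AddCommGroup E] [Module ℝ E]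
    (g : E →ᵃ[ℝ] E) {s : Set E} (hs : Convex ℝ s) (n : ℕ) : Convex ℝ (g^[n] ⁻¹' s) := by
  induction n with
  | zero => simpa using hs
  | succ n ih =>
    rw [Function.iterate_succ, Set.preimage_comp]
    exact ih.affine_preimage g

theorem AffineMap.convex_setOf_forall_iterate_mem {E : Type*} [AddCommGroup E] [Module ℝ E]
    (g : E →ᵃ[ℝ] E) {s : Set E} (hs : Convex ℝ s) : Convex ℝ {u | ∀ n : ℕ, g^[n] u ∈ s} := by
  rw [Set.ofPred_forall]
  exact convex_iInter fun n => g.convex_iterate_preimage hs n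

theorem AffineMap.convex_setOf_exists_iterate_mem {E : Type*} [AddCommGroup E] [Module ℝ E]
    (g : E →ᵃ[ℝ] E) {s : Set E} (hs : Convex ℝ s) (hg : Set.MapsTo g s s) :
    Convex ℝ {u | ∃ n : ℕ, g^[n] u ∈ s} := by
  rw [Set.ofPred_exists]
  refine Directed.convex_iUnion (Monotone.directed_le ?_) fun n => g.convex_iterate_preimage hs n
  refine monotone_nat_of_le_succ fun n u hu => ?_
  change g^[n + 1] u ∈ s
  rw [Function.iterate_succ_apply']
  exact hg hu

/-- For the affine map `f(x) = Ax + a` and the guard polytope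
`P = {x : Bx ≥ c}`, both the set `NT` of non-terminating points and the set
`ENT` of eventually non-terminating points are convex subsets of `ℝ^d`. -/
theorem NT_and_ENT_convex
    (d k : ℕ) (A : Matrix (Fin d) (Fin d) ℝ) (a : Fin d → ℝ)
    (B : Matrix (Fin k) (Fin d) ℝ) (c : Fin k → ℝ)
    (f : (Fin d → ℝ) → (Fin d → ℝ)) (hf : ∀ x, f x = A.mulVec x + a)
    (P : Set (Fin d → ℝ)) (hP : P = {x | ∀ i, c i ≤ B.mulVec x i})
    (NT : Set (Fin d → ℝ)) (hNT : NT = {u | ∀ n : ℕ, f^[n] u ∈ P})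
    (ENT : Set (Fin d → ℝ)) (hENT : ENT = {u | ∃ n : ℕ, f^[n] u ∈ NT}) :
    Convex ℝ NT ∧ Convex ℝ ENT := by
  obtain ⟨g, rfl⟩ : ∃ g : (Fin d → ℝ) →ᵃ[ℝ] (Fin d → ℝ), ⇑g = f :=
    ⟨A.mulVecLin.toAffineMap + AffineMap.const ℝ _ a, by ext x : 1; simp [hf]⟩
  have hPc : Convex ℝ P := by
    rw [hP]
    exact (convex_Ici c).linear_preimage B.mulVecLin
  have hNTc : Convex ℝ NT := hNT ▸ g.convex_setOf_forall_iterate_mem hPc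
  refine ⟨hNTc, hENT ▸ g.convex_setOf_exists_iterate_mem hNTc ?_⟩
  rw [hNT]
  exact fun u hu n => hu (n + 1)
end

section
/- Let A be a square complex matrix and let L be a positive integer such that for all eigenvalues λ₁ ≠ λ₂ of A, if λ₁/λ₂ is a root of unity then (λ₁/λ₂)^L = 1 (e.g., L the least common multiple of the orders of all eigenvalue ratios of A that are roots of unity). Then A^L is non-degenerate: every eigenvalue of A^L is of the form λ^L for an eigenvalue λ of A, and for all distinct eigenvalues μ₁ ≠ μ₂ of A^L, the ratio μ₁/μ₂ is not a root of unity. -/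
/-- If `L > 0` is such that `(λ₁/λ₂)^L = 1` whenever `λ₁ ≠ λ₂` are eigenvalues of
`A` whose ratio is a root of unity, then `A^L` is non-degenerate: every
eigenvalue of `A^L` has the form `λ^L` for an eigenvalue `λ` of `A`, and no
ratio of distinct eigenvalues of `A^L` is a root of unity. -/
theorem power_matrix_nondegenerate
    (d : ℕ) (A : Matrix (Fin d) (Fin d) ℂ) (L : ℕ) (hL : 0 < L)
    (h : ∀ μ₁ ∈ spectrum ℂ A, ∀ μ₂ ∈ spectrum ℂ A, μ₁ ≠ μ₂ →
      (∃ r : ℕ, 0 < r ∧ (μ₁ / μ₂) ^ r = 1) → (μ₁ / μ₂) ^ L = 1) :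
    (∀ ν ∈ spectrum ℂ (A ^ L), ∃ μ ∈ spectrum ℂ A, ν = μ ^ L) ∧
    (∀ ν₁ ∈ spectrum ℂ (A ^ L), ∀ ν₂ ∈ spectrum ℂ (A ^ L), ν₁ ≠ ν₂ →
      ∀ r : ℕ, 0 < r → (ν₁ / ν₂) ^ r ≠ 1) := by
  have hpow : ∀ ν ∈ spectrum ℂ (A ^ L), ∃ μ ∈ spectrum ℂ A, ν = μ ^ L := by
    intro ν hν
    rw [spectrum.map_pow_of_pos A hL] at hν
    obtain ⟨μ, hμ, rfl⟩ := hν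
    exact ⟨μ, hμ, rfl⟩
  refine ⟨hpow, fun ν₁ hν₁ ν₂ hν₂ hne r hr hroot => hne ?_⟩
  obtain ⟨μ₁, hμ₁, rfl⟩ := hpow ν₁ hν₁
  obtain ⟨μ₂, hμ₂, rfl⟩ := hpow ν₂ hν₂
  rw [← div_pow, ← pow_mul] at hroot
  have hratio := h μ₁ hμ₁ μ₂ hμ₂ (fun heq => hne (by rw [heq]))
    ⟨L * r, Nat.mul_pos hL hr, hroot⟩
  rw [div_pow] at hratio
  exact eq_of_div_eq_one hratio
end
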